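/- arXiv:2310.05698 — 6 statements merged into one kernel-verified Lean document; each statement's English description precedes it below -/
import Mathlib

section
/- Under the attack-free setting, with the decreasing step size γ^k = 2/(β̃(k₀+k)) where k₀ is any integer with k₀ ≥ max{1/(α̃β̃), √(72(3−σ)/((2−σ)σ²u_f²J²β̃²)), 1/(√(2/(2−σ²))−1)}, the primal iterates of the attack-free decentralized resource allocation algorithm converge to the optimal allocation: lim_{k→∞} ‖Θ̃^{k+1} − Θ̃*‖ = 0, where Θ̃^{k} := (θ_1^{k}, …, θ_J^{k}) ∈ ℝ^{JD} stacks the local primal variables. -/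
open Filter Finset
open scoped BigOperators Topology InnerProductSpace

section Sequences

theorem summable_of_le_mul_add {x y : ℕ → ℝ} {q : ℝ} (hq : q < 1) (hx : ∀ k, 0 ≤ x k)
    (hy : ∀ k, 0 ≤ y k) (hys : Summable y) (h : ∀ k, x (k + 1) ≤ q * x k + y k) :
    Summable x := by
  refine summable_of_sum_range_le (c := (x 0 + ∑' k, y k) / (1 - q)) hx fun n => ?_
  rw [le_div_iff₀ (by linarith)]
  have h1 : ∑ k ∈ range n, x (k + 1) ≤ q * ∑ k ∈ range n, x k + ∑ k ∈ range n, y k := by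
    rw [mul_sum, ← sum_add_distrib]
    exact sum_le_sum fun k _ => h k
  have h2 : ∑ k ∈ range n, y k ≤ ∑' k, y k := hys.sum_le_tsum _ fun k _ => hy k
  have h3 : ∑ k ∈ range n, x (k + 1) + x 0 = ∑ k ∈ range n, x k + x n := by
    rw [← sum_range_succ' x n, sum_range_succ]
  nlinarith [hx n]

theorem summable_of_descent {V a y : ℕ → ℝ} (hV : ∀ k, 0 ≤ V k) (ha : ∀ k, 0 ≤ a k)
    (hy : ∀ k, 0 ≤ y k) (hys : Summable y) (h : ∀ k, V (k + 1) ≤ V k - a k + y k) :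
    Summable a := by
  refine summable_of_sum_range_le (c := V 0 + ∑' k, y k) ha fun n => ?_
  have h1 : ∑ k ∈ range n, a k + V n ≤ V 0 + ∑ k ∈ range n, y k := by
    induction n with
    | zero => simp
    | succ n ih => rw [sum_range_succ, sum_range_succ]; linarith [h n]
  linarith [hV n, hys.sum_le_tsum (range n) fun k _ => hy k]

theorem exists_tendsto_of_le_add_summable {w y : ℕ → ℝ} (hw : ∀ k, 0 ≤ w k)
    (hy : ∀ k, 0 ≤ y k) (hys : Summable y) (h : ∀ k, w (k + 1) ≤ w k + y k) :
    ∃ l, Tendsto w atTop (𝓝 l) := by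
  have hanti : Antitone fun k => w k - ∑ j ∈ range k, y j :=
    antitone_nat_of_succ_le fun k => by rw [sum_range_succ]; linarith [h k]
  have hbdd : BddBelow (Set.range fun k => w k - ∑ j ∈ range k, y j) := by
    refine ⟨-∑' j, y j, ?_⟩
    rintro _ ⟨k, rfl⟩
    have := hys.sum_le_tsum (range k) fun j _ => hy j
    dsimp only
    linarith [hw k]
  refine ⟨_, ((tendsto_atTop_ciInf hanti hbdd).add hys.hasSum.tendsto_sum_nat).congr
    fun k => ?_⟩
  ring

theorem tendsto_zero_of_summable_mul {b γ : ℕ → ℝ} {c : ℝ} (hc : 0 ≤ c) (hb : ∀ k, 0 ≤ b k)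
    (hγ : ∀ k, 0 ≤ γ k) (hγns : ¬ Summable γ) (hγsq : Summable fun k => γ k ^ 2)
    (hγb : Summable fun k => γ k * b k) (h : ∀ k, b (k + 1) ≤ b k + c * γ k) :
    Tendsto b atTop (𝓝 0) := by
  obtain ⟨l, hl⟩ := exists_tendsto_of_le_add_summable (w := fun k => b k ^ 2)
    (y := fun k => 2 * c * (γ k * b k) + c ^ 2 * γ k ^ 2) (fun k => sq_nonneg _)
    (fun k => by have := hγ k; have := hb k; positivity)
    ((hγb.mul_left _).add (hγsq.mul_left _))
    (fun k => by
      have := pow_le_pow_left₀ (hb (k + 1)) (h k) 2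
      linarith)
  have hbl : Tendsto b atTop (𝓝 (√l)) :=
    ((Real.continuous_sqrt.tendsto l).comp hl).congr fun k => Real.sqrt_sq (hb k)
  rcases (Real.sqrt_nonneg l).eq_or_lt with h0 | hpos
  · rwa [h0]
  refine absurd ?_ hγns
  have hev : ∀ᶠ k in atTop, √l / 2 ≤ b k :=
    (hbl.eventually (lt_mem_nhds (half_lt_self hpos))).mono fun k hk => hk.le
  obtain ⟨N, hN⟩ := eventually_atTop.1 hev
  rw [← summable_nat_add_iff N]
  refine Summable.of_nonneg_of_le (fun k => hγ _) (fun k => ?_)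
    (((summable_nat_add_iff N).2 hγb).mul_left (√l / 2)⁻¹)
  rw [← div_eq_inv_mul, le_div_iff₀ (by positivity)]
  exact mul_le_mul_of_nonneg_left (hN _ (Nat.le_add_left _ _)) (hγ _)

theorem not_summable_div_add_natCast {c : ℝ} (hc : c ≠ 0) (n : ℕ) :
    ¬ Summable fun k : ℕ => c / ((n : ℝ) + k) := by
  intro h
  have h2 : Summable fun k : ℕ => ((k + n : ℕ) : ℝ)⁻¹ :=
    (h.mul_left c⁻¹).congr fun k => by push_cast; rw [add_comm]; field_simp
  exact Real.not_summable_natCast_inv ((summable_nat_add_iff n).1 h2)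

theorem summable_div_add_natCast_sq (c : ℝ) (n : ℕ) :
    Summable fun k : ℕ => (c / ((n : ℝ) + k)) ^ 2 := by
  have h := (summable_nat_add_iff n).2 (Real.summable_nat_pow_inv.2 one_lt_two)
  refine (h.mul_left (c ^ 2)).congr fun k => ?_
  push_cast
  rw [add_comm, div_pow, div_eq_mul_inv]

end Sequences

section Prox

variable {E : Type*} [NormedAddCommGroup E] [InnerProductSpace ℝ E]

/-- `p` minimizes `θ ↦ ⟪lam, θ⟫ + f θ` over `C`. -/
def IsTiltedMin (f : E → ℝ) (C : Set E) (lam p : E) : Prop :=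
  p ∈ C ∧ ∀ θ ∈ C, ⟪lam, p⟫_ℝ + f p ≤ ⟪lam, θ⟫_ℝ + f θ

namespace IsTiltedMin

variable {f : E → ℝ} {C : Set E} {m : ℝ} {lam mu p q : E}

theorem quadratic_growth (hf : StrongConvexOn Set.univ m f) (hC : Convex ℝ C)
    (hp : IsTiltedMin f C lam p) {θ : E} (hθ : θ ∈ C) :
    ⟪lam, p⟫_ℝ + f p + m / 4 * ‖θ - p‖ ^ 2 ≤ ⟪lam, θ⟫_ℝ + f θ := by
  have h12 : (0 : ℝ) ≤ 1 / 2 := by norm_num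
  have hsum : (1 / 2 : ℝ) + 1 / 2 = 1 := by norm_num
  have h1 := hp.2 _ (hC hθ hp.1 h12 h12 hsum)
  have h2 := hf.2 (Set.mem_univ θ) (Set.mem_univ p) h12 h12 hsum
  simp only [inner_add_right, inner_smul_right, smul_eq_mul] at h1 h2
  linarith

theorem strongly_monotone (hf : StrongConvexOn Set.univ m f) (hC : Convex ℝ C)
    (hp : IsTiltedMin f C lam p) (hq : IsTiltedMin f C mu q) :
    m / 2 * ‖p - q‖ ^ 2 ≤ ⟪lam - mu, q - p⟫_ℝ := by
  have h1 := hp.quadratic_growth hf hC hq.1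
  have h2 := hq.quadratic_growth hf hC hp.1
  rw [norm_sub_rev] at h1
  simp only [inner_sub_left, inner_sub_right]
  linarith

theorem norm_sub_le (hm : 0 < m) (hf : StrongConvexOn Set.univ m f) (hC : Convex ℝ C)
    (hp : IsTiltedMin f C lam p) (hq : IsTiltedMin f C mu q) :
    ‖p - q‖ ≤ 2 / m * ‖lam - mu‖ := by
  have h1 := hp.strongly_monotone hf hC hq
  have h2 := real_inner_le_norm (lam - mu) (q - p)
  rw [norm_sub_rev q p] at h2
  rw [div_mul_eq_mul_div, le_div_iff₀ hm]
  by_contra! hlt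
  have hpos : 0 < ‖p - q‖ := by
    by_contra! h0
    have : ‖p - q‖ = 0 := le_antisymm h0 (norm_nonneg _)
    rw [this] at hlt
    linarith [norm_nonneg (lam - mu)]
  nlinarith

theorem sSup_conjugate (hp : IsTiltedMin f C lam p) :
    sSup ((fun θ => ⟪-lam, θ⟫_ℝ - f θ) '' C) = ⟪-lam, p⟫_ℝ - f p := by
  refine IsGreatest.csSup_eq ⟨⟨p, hp.1, rfl⟩, ?_⟩
  rintro _ ⟨θ, hθ, rfl⟩
  have := hp.2 θ hθ
  simp only [inner_neg_left]
  linarith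

end IsTiltedMin

variable {ι : Type*} [Fintype ι] {f : ι → E → ℝ} {C : ι → Set E} {m : ℝ}
  {prox : ι → E → E}

/-- The dual function `∑ i, (⟪lam, s - prox i lam⟫ - f i (prox i lam))` is stationary at its
minimizer. -/
theorem sum_sub_prox_eq_zero (hm : 0 < m) (hf : ∀ i, StrongConvexOn Set.univ m (f i))
    (hC : ∀ i, Convex ℝ (C i)) (hprox : ∀ i lam, IsTiltedMin (f i) (C i) lam (prox i lam))
    {s lamstar : E}
    (hopt : ∀ lam, ∑ i, (⟪lamstar, s - prox i lamstar⟫_ℝ - f i (prox i lamstar)) ≤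
      ∑ i, (⟪lam, s - prox i lam⟫_ℝ - f i (prox i lam))) :
    ∑ i, (s - prox i lamstar) = 0 := by
  have hkey : ∀ lam, ⟪lamstar - lam, ∑ i, (s - prox i lam)⟫_ℝ ≤ 0 := by
    intro lam
    have h1 : ∑ i, (⟪lamstar, s - prox i lam⟫_ℝ - f i (prox i lam)) ≤
        ∑ i, (⟪lamstar, s - prox i lamstar⟫_ℝ - f i (prox i lamstar)) := by
      refine sum_le_sum fun i _ => ?_
      have := (hprox i lamstar).2 _ (hprox i lam).1
      simp only [inner_sub_right]
      linarith
    have h2 := h1.trans (hopt lam)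
    rw [inner_sub_left, inner_sum, inner_sum]
    simp only [sum_sub_distrib] at h2
    linarith
  set v := ∑ i, (s - prox i lamstar) with hv
  have hcont : ∀ i, Continuous (prox i) := fun i =>
    (LipschitzWith.of_dist_le_mul (K := ⟨2 / m, by positivity⟩) fun x y => by
      rw [dist_eq_norm, dist_eq_norm]
      exact (hprox i x).norm_sub_le hm (hf i) (hC i) (hprox i y)).continuous
  have hcφ : Continuous fun t : ℝ => ⟪v, ∑ i, (s - prox i (lamstar - t • v))⟫_ℝ := by
    have := hcont
    fun_prop
  have hpos : ∀ t ∈ Set.Ioi (0 : ℝ), ⟪v, ∑ i, (s - prox i (lamstar - t • v))⟫_ℝ ≤ 0 := by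
    intro t ht
    have h := hkey (lamstar - t • v)
    rw [sub_sub_cancel, real_inner_smul_left] at h
    exact nonpos_of_mul_nonpos_right h ht
  have h0 : ⟪v, ∑ i, (s - prox i (lamstar - (0 : ℝ) • v))⟫_ℝ ≤ 0 :=
    le_of_tendsto (hcφ.continuousWithinAt (s := Set.Ioi 0) (x := 0))
      (eventually_nhdsWithin_of_forall hpos)
  rw [zero_smul, sub_zero, ← hv, real_inner_self_eq_norm_sq] at h0
  have : ‖v‖ = 0 := by nlinarith [norm_nonneg v]
  exact norm_eq_zero.1 this

theorem optimal_eq_of_isTiltedMin (hm : 0 < m) (hf : ∀ i, StrongConvexOn Set.univ m (f i))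
    (hC : ∀ i, Convex ℝ (C i)) {lam : E} {p Θ : ι → E}
    (hp : ∀ i, IsTiltedMin (f i) (C i) lam (p i)) (hΘ : ∀ i, Θ i ∈ C i)
    (hsum : ∑ i, Θ i = ∑ i, p i) (hle : ∑ i, f i (Θ i) ≤ ∑ i, f i (p i)) : Θ = p := by
  have h1 := sum_le_sum fun i (_ : i ∈ univ) => (hp i).quadratic_growth (hf i) (hC i) (hΘ i)
  simp only [sum_add_distrib, ← inner_sum, hsum, ← mul_sum] at h1
  have h2 : ∑ i, ‖Θ i - p i‖ ^ 2 ≤ 0 := by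
    by_contra! h
    have := mul_pos (by positivity : 0 < m / 4) h
    linarith
  have h3 := (sum_eq_zero_iff_of_nonneg fun i _ => sq_nonneg ‖Θ i - p i‖).1
    (le_antisymm h2 (sum_nonneg fun i _ => sq_nonneg _))
  funext i
  simpa [sub_eq_zero] using h3 i (mem_univ i)

end Prox

section Mixing

theorem sum_norm_sq_matrix_smul_le {D J : ℕ} (A : Matrix (Fin J) (Fin J) ℝ)
    (x : Fin J → EuclideanSpace ℝ (Fin D)) :
    ∑ i, ‖∑ j, A i j • x j‖ ^ 2 ≤
      ‖LinearMap.toContinuousLinearMap (Matrix.toEuclideanLin A)‖ ^ 2 * ∑ j, ‖x j‖ ^ 2 := by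
  simp only [EuclideanSpace.real_norm_sq_eq]
  rw [sum_comm, sum_comm (γ := Fin J), mul_sum]
  refine sum_le_sum fun d _ => ?_
  have h := (LinearMap.toContinuousLinearMap (Matrix.toEuclideanLin A)).le_opNorm
    (WithLp.toLp 2 fun j => x j d)
  have h2 := pow_le_pow_left₀ (norm_nonneg _) h 2
  rw [mul_pow, EuclideanSpace.real_norm_sq_eq, EuclideanSpace.real_norm_sq_eq] at h2
  simpa [Matrix.toLpLin_apply, Matrix.mulVec, dotProduct] using h2

theorem norm_sub_sq_le_young {E : Type*} [NormedAddCommGroup E] (a b : E) {η : ℝ}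
    (hη : 0 < η) : ‖a - b‖ ^ 2 ≤ (1 + η) * ‖a‖ ^ 2 + (1 + η⁻¹) * ‖b‖ ^ 2 := by
  have h1 : ‖a - b‖ ^ 2 ≤ (‖a‖ + ‖b‖) ^ 2 := by
    gcongr
    exact _root_.norm_sub_le a b
  have h2 : 2 * ‖a‖ * ‖b‖ ≤ η * ‖a‖ ^ 2 + η⁻¹ * ‖b‖ ^ 2 := by
    have : η * ‖a‖ ^ 2 + η⁻¹ * ‖b‖ ^ 2 - 2 * ‖a‖ * ‖b‖ = η⁻¹ * (η * ‖a‖ - ‖b‖) ^ 2 := by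
      field_simp
      ring
    have h3 : 0 ≤ η⁻¹ * (η * ‖a‖ - ‖b‖) ^ 2 := by positivity
    linarith
  linarith

end Mixing

section Iteration

variable {D J : ℕ} {Emix : Matrix (Fin J) (Fin J) ℝ}

/-- The average of the local vectors. -/
noncomputable def agentMean (x : Fin J → EuclideanSpace ℝ (Fin D)) : EuclideanSpace ℝ (Fin D) :=
  (J : ℝ)⁻¹ • ∑ i, x i

theorem agentMean_mix (hEcol : ∀ j, ∑ i, Emix i j = 1)
    (x : Fin J → EuclideanSpace ℝ (Fin D)) :
    agentMean (fun i => ∑ j, Emix i j • x j) = agentMean x := by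
  unfold agentMean
  rw [sum_comm]
  simp only [← sum_smul, hEcol, one_smul]

theorem sum_norm_sq_mix_sub_mean_le (hJ : 1 ≤ J) (hErow : ∀ i, ∑ j, Emix i j = 1)
    (x : Fin J → EuclideanSpace ℝ (Fin D)) (c : EuclideanSpace ℝ (Fin D)) :
    ∑ i, ‖∑ j, Emix i j • x j - agentMean x‖ ^ 2 ≤
      ‖LinearMap.toContinuousLinearMap (Matrix.toEuclideanLin
        (Emix - (Matrix.of fun _ _ => (J : ℝ)⁻¹ : Matrix (Fin J) (Fin J) ℝ)))‖ ^ 2 *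
        ∑ j, ‖x j - c‖ ^ 2 := by
  have hJ0 : (J : ℝ) ≠ 0 := by positivity
  refine le_trans (le_of_eq (sum_congr rfl fun i _ => ?_))
    (sum_norm_sq_matrix_smul_le _ fun j => x j - c)
  congr 2
  simp only [Matrix.sub_apply, Matrix.of_apply, sub_smul, smul_sub, sum_sub_distrib,
    ← sum_smul, hErow, agentMean, ← smul_sum]
  simp [hJ0]

/-- The consensus error of perturbed gossip with square-summable step sizes is
square-summable. -/
theorem summable_consensus_error (hJ : 1 ≤ J) (hErow : ∀ i, ∑ j, Emix i j = 1)
    (hEcol : ∀ j, ∑ i, Emix i j = 1)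
    (hκ : ‖LinearMap.toContinuousLinearMap (Matrix.toEuclideanLin
        (Emix - (Matrix.of fun _ _ => (J : ℝ)⁻¹ : Matrix (Fin J) (Fin J) ℝ)))‖ ^ 2 < 1)
    {γ : ℕ → ℝ} (hγsq : Summable fun k => γ k ^ 2) {B : ℝ}
    {lam d : ℕ → Fin J → EuclideanSpace ℝ (Fin D)} (hd : ∀ k i, ‖d k i‖ ≤ B)
    (hnext : ∀ k i, lam (k + 1) i = ∑ j, Emix i j • (lam k j - γ k • d k j)) :
    Summable fun k => ∑ i, ‖lam k i - agentMean (lam k)‖ ^ 2 := by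
  set κ := ‖LinearMap.toContinuousLinearMap (Matrix.toEuclideanLin
        (Emix - (Matrix.of fun _ _ => (J : ℝ)⁻¹ : Matrix (Fin J) (Fin J) ℝ)))‖ ^ 2 with hκdef
  have hκ0 : 0 ≤ κ := sq_nonneg _
  have hη : 0 < 1 - κ := by linarith
  refine summable_of_le_mul_add (q := κ * (1 + (1 - κ)))
    (y := fun k => κ * ((1 + (1 - κ)⁻¹) * (J * B ^ 2)) * γ k ^ 2) (by nlinarith)
    (fun k => sum_nonneg fun i _ => sq_nonneg _) (fun k => by positivity)
    (hγsq.mul_left _) fun k => ?_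
  have hlam : lam (k + 1) = fun i => ∑ j, Emix i j • (lam k j - γ k • d k j) := funext (hnext k)
  rw [hlam, agentMean_mix hEcol]
  refine (sum_norm_sq_mix_sub_mean_le hJ hErow _ (agentMean (lam k))).trans ?_
  rw [← hκdef]
  have hterm : ∀ j, ‖lam k j - γ k • d k j - agentMean (lam k)‖ ^ 2 ≤
      (1 + (1 - κ)) * ‖lam k j - agentMean (lam k)‖ ^ 2 +
        (1 + (1 - κ)⁻¹) * (γ k ^ 2 * B ^ 2) := by
    intro j
    rw [sub_right_comm]
    refine (norm_sub_sq_le_young _ _ hη).trans ?_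
    rw [norm_smul, mul_pow, Real.norm_eq_abs, sq_abs]
    gcongr
    exact hd k j
  have hs := mul_le_mul_of_nonneg_left (sum_le_sum fun j (_ : j ∈ univ) => hterm j) hκ0
  refine hs.trans (le_of_eq ?_)
  rw [sum_add_distrib, ← mul_sum, sum_const, card_univ, Fintype.card_fin, nsmul_eq_mul]
  ring

end Iteration

set_option maxHeartbeats 1000000 in
theorem statement_1
    (D J : ℕ) (hJ : 1 ≤ J)
    (uf Lf : ℝ) (huf : 0 < uf) (hufLf : uf ≤ Lf)
    (f : Fin J → EuclideanSpace ℝ (Fin D) → ℝ)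
    (C : Fin J → Set (EuclideanSpace ℝ (Fin D)))
    (hCne : ∀ i, (C i).Nonempty)
    (hCcpt : ∀ i, IsCompact (C i))
    (hCcvx : ∀ i, Convex ℝ (C i))
    (hfsc : ∀ i, StrongConvexOn Set.univ uf (f i))
    (hfdiff : ∀ i, Differentiable ℝ (f i))
    (hfsm : ∀ i x y, ‖gradient (f i) x - gradient (f i) y‖ ≤ Lf * ‖x - y‖)
    (s : EuclideanSpace ℝ (Fin D))
    -- `prox i lam` is the minimizer of `θ ↦ ⟪lam, θ⟫ + f i θ` over `C i`
    (prox : Fin J → EuclideanSpace ℝ (Fin D) → EuclideanSpace ℝ (Fin D))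
    (hprox : ∀ i lam, prox i lam ∈ C i ∧
      ∀ θ ∈ C i, ⟪lam, prox i lam⟫_ℝ + f i (prox i lam) ≤ ⟪lam, θ⟫_ℝ + f i θ)
    -- conjugate functions and local dual functions
    (Fstar : Fin J → EuclideanSpace ℝ (Fin D) → ℝ)
    (hFstar : ∀ i lam, Fstar i lam = sSup ((fun θ => ⟪lam, θ⟫_ℝ - f i θ) '' C i))
    (g : Fin J → EuclideanSpace ℝ (Fin D) → ℝ)
    (hgdef : ∀ i lam, g i lam = (J : ℝ)⁻¹ * Fstar i (-lam) + (J : ℝ)⁻¹ * ⟪lam, s⟫_ℝ)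
    -- gradients of the local dual functions
    (gradg : Fin J → EuclideanSpace ℝ (Fin D) → EuclideanSpace ℝ (Fin D))
    (hgradg : ∀ i lam, gradg i lam = (J : ℝ)⁻¹ • s - (J : ℝ)⁻¹ • prox i lam)
    -- uniform bound on the deviation of the local dual gradients
    (δ : ℝ) (hδ0 : 0 ≤ δ)
    (hδ : ∀ (lam : EuclideanSpace ℝ (Fin D)) (i : Fin J),
      ‖gradg i lam - (J : ℝ)⁻¹ • ∑ j, gradg j lam‖ ^ 2 ≤ δ ^ 2)
    -- doubly stochastic mixing matrix with κ˜ < 1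
    (Emix : Matrix (Fin J) (Fin J) ℝ)
    (hEnn : ∀ i j, 0 ≤ Emix i j)
    (hErow : ∀ i, ∑ j, Emix i j = 1)
    (hEcol : ∀ j, ∑ i, Emix i j = 1)
    (κ : ℝ)
    (hκ : κ = ‖LinearMap.toContinuousLinearMap (Matrix.toEuclideanLin
        (Emix - (Matrix.of fun _ _ => (J : ℝ)⁻¹ : Matrix (Fin J) (Fin J) ℝ)))‖ ^ 2)
    (hκlt : κ < 1)
    (σ : ℝ) (hσ : σ = 1 - κ)
    -- Slater's condition
    (hSlater : ∃ Θ : Fin J → EuclideanSpace ℝ (Fin D),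
      (∀ i, Θ i ∈ intrinsicInterior ℝ (C i)) ∧ (J : ℝ)⁻¹ • ∑ i, Θ i = s)
    -- optimal primal-dual pair
    (Θstar : Fin J → EuclideanSpace ℝ (Fin D)) (lamstar : EuclideanSpace ℝ (Fin D))
    (hΘfeas : (∀ i, Θstar i ∈ C i) ∧ (J : ℝ)⁻¹ • ∑ i, Θstar i = s)
    (hΘopt : ∀ Θ : Fin J → EuclideanSpace ℝ (Fin D), (∀ i, Θ i ∈ C i) →
      (J : ℝ)⁻¹ • ∑ i, Θ i = s →
      (J : ℝ)⁻¹ * ∑ i, f i (Θstar i) ≤ (J : ℝ)⁻¹ * ∑ i, f i (Θ i))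
    (hlamopt : ∀ lam' : EuclideanSpace ℝ (Fin D), ∑ i, g i lamstar ≤ ∑ i, g i lam')
    -- constants α˜, β˜ and the step size
    (α β : ℝ)
    (hα : α = J * uf * Lf / (uf + Lf))
    (hβ : β = 1 / (J * (uf + Lf)))
    (k₀ : ℕ)
    (hk₀ : max (max (1 / (α * β))
          (Real.sqrt (72 * (3 - σ) / ((2 - σ) * σ ^ 2 * uf ^ 2 * (J : ℝ) ^ 2 * β ^ 2))))
        (1 / (Real.sqrt (2 / (2 - σ ^ 2)) - 1)) ≤ (k₀ : ℝ))
    (γ : ℕ → ℝ) (hγ : ∀ k, γ k = 2 / (β * ((k₀ : ℝ) + (k : ℝ))))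
    -- the attack-free decentralized resource allocation algorithm
    (lam lamh θv : ℕ → Fin J → EuclideanSpace ℝ (Fin D))
    (lam0 : EuclideanSpace ℝ (Fin D)) (hinit : ∀ i, lam 0 i = lam0)
    (hθ : ∀ k i, θv k i = prox i (lam k i))
    (hhalf : ∀ k i, lamh k i = lam k i - γ k • ((J : ℝ)⁻¹ • s - (J : ℝ)⁻¹ • θv k i))
    (hnext : ∀ k i, lam (k + 1) i = ∑ j, Emix i j • lamh k j)
    :
    Tendsto (fun k => Real.sqrt (∑ i, ‖θv (k + 1) i - Θstar i‖ ^ 2)) atTop (𝓝 0) := by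
  have hJ1 : (1 : ℝ) ≤ J := by exact_mod_cast hJ
  have hJpos : (0 : ℝ) < J := by linarith
  have hJinv : (J : ℝ)⁻¹ ≤ 1 := inv_le_one_of_one_le₀ hJ1
  have hβpos : 0 < β := by
    rw [hβ]
    have : 0 < uf + Lf := by linarith
    positivity
  have hmin : ∀ i lam, IsTiltedMin (f i) (C i) lam (prox i lam) := hprox
  -- duality: the optimal allocation is the response to the optimal multiplier
  have hgsum : ∀ mu, ∑ i, g i mu =
      (J : ℝ)⁻¹ * ∑ i, (⟪mu, s - prox i mu⟫_ℝ - f i (prox i mu)) := by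
    intro mu
    rw [mul_sum]
    refine sum_congr rfl fun i _ => ?_
    rw [hgdef, hFstar, (hmin i mu).sSup_conjugate, inner_neg_left, inner_sub_right]
    ring
  have hstat : ∑ i, (s - prox i lamstar) = 0 := by
    refine sum_sub_prox_eq_zero huf hfsc hCcvx hmin fun mu => ?_
    have h := hlamopt mu
    rw [hgsum, hgsum] at h
    exact le_of_mul_le_mul_left h (by positivity)
  have hproxsum : ∑ i, prox i lamstar = (J : ℝ) • s := by
    rw [sum_sub_distrib, sum_const, card_univ, Fintype.card_fin, sub_eq_zero] at hstat
    rw [← hstat, Nat.cast_smul_eq_nsmul]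
  have hΘsum : ∑ i, Θstar i = (J : ℝ) • s := by
    rw [← hΘfeas.2, smul_inv_smul₀ hJpos.ne']
  have hΘeq : Θstar = fun i => prox i lamstar := by
    refine optimal_eq_of_isTiltedMin huf hfsc hCcvx (fun i => hmin i lamstar) hΘfeas.1
      (hΘsum.trans hproxsum.symm) ?_
    refine le_of_mul_le_mul_left (hΘopt _ (fun i => (hmin i lamstar).1) ?_)
      (by positivity : (0 : ℝ) < (J : ℝ)⁻¹)
    rw [hproxsum, inv_smul_smul₀ hJpos.ne']
  -- uniform bounds
  obtain ⟨R, hR⟩ := (isCompact_iUnion hCcpt).isBounded.exists_norm_le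
  have hRC : ∀ i, ∀ θ ∈ C i, ‖θ‖ ≤ R := fun i θ hθ => hR θ (Set.mem_iUnion.2 ⟨i, hθ⟩)
  have hR0 : 0 ≤ R := (norm_nonneg _).trans (hRC ⟨0, hJ⟩ _ (hΘfeas.1 _))
  have hdiff : ∀ i, ∀ θ ∈ C i, ∀ θ' ∈ C i, ‖θ - θ'‖ ≤ 2 * R := fun i θ hθ θ' hθ' =>
    (norm_sub_le θ θ').trans (by linarith [hRC i θ hθ, hRC i θ' hθ'])
  have hθC : ∀ k i, θv k i ∈ C i := fun k i => hθ k i ▸ (hmin i _).1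
  set d : ℕ → Fin J → EuclideanSpace ℝ (Fin D) :=
    fun k i => (J : ℝ)⁻¹ • s - (J : ℝ)⁻¹ • θv k i with hd
  set B : ℝ := ‖s‖ + R with hB
  have hB0 : 0 ≤ B := by positivity
  have hdB : ∀ k i, ‖d k i‖ ≤ B := by
    intro k i
    have h1 : ‖s - θv k i‖ ≤ B := (norm_sub_le _ _).trans (by linarith [hRC i _ (hθC k i)])
    simp only [hd, ← smul_sub]
    rw [norm_smul, Real.norm_of_nonneg (by positivity)]
    nlinarith [norm_nonneg (s - θv k i)]
  -- step sizes
  have hγeq : γ = fun k : ℕ => 2 / β / ((k₀ : ℝ) + k) := by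
    funext k
    rw [hγ, div_div]
  have hγ0 : ∀ k, 0 ≤ γ k := fun k => by rw [hγ]; positivity
  have hγns : ¬ Summable γ := hγeq ▸ not_summable_div_add_natCast (by positivity) k₀
  have hγsq : Summable fun k => γ k ^ 2 := hγeq ▸ summable_div_add_natCast_sq _ k₀
  -- consensus
  have hstep : ∀ k i, lam (k + 1) i = ∑ j, Emix i j • (lam k j - γ k • d k j) := fun k i => by
    simp only [hnext, hhalf, hd]
  have hcons := summable_consensus_error hJ hErow hEcol (hκ ▸ hκlt) hγsq hdB hstep
  set m : ℕ → EuclideanSpace ℝ (Fin D) := fun k => agentMean (lam k) with hm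
  have hmean : ∀ k, m (k + 1) = m k - γ k • agentMean (d k) := by
    intro k
    have : lam (k + 1) = fun i => ∑ j, Emix i j • (lam k j - γ k • d k j) := funext (hstep k)
    simp only [hm]
    rw [this, agentMean_mix hEcol]
    simp only [agentMean, sum_sub_distrib, smul_sub, ← smul_sum]
    rw [smul_comm]
  have hmeanB : ∀ k, ‖agentMean (d k)‖ ≤ B := by
    intro k
    rw [agentMean, norm_smul, Real.norm_of_nonneg (by positivity), inv_mul_le_iff₀ hJpos]
    refine (norm_sum_le_of_le _ fun i _ => hdB k i).trans (le_of_eq ?_)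
    simp
  have hmeand : ∀ k, agentMean (d k) = ((J : ℝ)⁻¹ * (J : ℝ)⁻¹) • ∑ i, (Θstar i - θv k i) := by
    intro k
    simp only [agentMean, hd, sum_sub_distrib, hΘsum, sum_const, card_univ, Fintype.card_fin,
      ← smul_sum, mul_smul, smul_sub]
    rw [inv_smul_smul₀ hJpos.ne', ← Nat.cast_smul_eq_nsmul ℝ, smul_inv_smul₀ hJpos.ne']
  have hlocal : ∀ k i, uf * γ k * ‖θv k i - Θstar i‖ ^ 2 ≤
      2 * γ k * ⟪m k - lamstar, Θstar i - θv k i⟫_ℝ +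
        (‖lam k i - m k‖ ^ 2 + (2 * R) ^ 2 * γ k ^ 2) := by
    intro k i
    have h1 := (hmin i (lam k i)).strongly_monotone (hfsc i) (hCcvx i) (hmin i lamstar)
    rw [← hθ, show prox i lamstar = Θstar i by rw [hΘeq]] at h1
    have h2 := real_inner_le_norm (lam k i - m k) (Θstar i - θv k i)
    have h3 : ‖Θstar i - θv k i‖ ≤ 2 * R := hdiff i _ (hΘfeas.1 i) _ (hθC k i)
    have h4 : ⟪lam k i - lamstar, Θstar i - θv k i⟫_ℝ =
        ⟪lam k i - m k, Θstar i - θv k i⟫_ℝ + ⟪m k - lamstar, Θstar i - θv k i⟫_ℝ := by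
      rw [← inner_add_left, sub_add_sub_cancel]
    have h5 := mul_le_mul_of_nonneg_left h3 (norm_nonneg (lam k i - m k))
    have h6 : uf / 2 * ‖θv k i - Θstar i‖ ^ 2 ≤
        ‖lam k i - m k‖ * (2 * R) + ⟪m k - lamstar, Θstar i - θv k i⟫_ℝ := by linarith
    have h7 := mul_le_mul_of_nonneg_left h6 (hγ0 k)
    nlinarith [sq_nonneg (‖lam k i - m k‖ - γ k * (2 * R))]
  have hγθ : Summable fun k => γ k * ∑ i, ‖θv k i - Θstar i‖ ^ 2 := by
    have hc : (J : ℝ)⁻¹ * (J : ℝ)⁻¹ * uf ≠ 0 := by positivity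
    rw [← summable_mul_left_iff hc]
    refine summable_of_descent (V := fun k => ‖m k - lamstar‖ ^ 2)
      (y := fun k => (J : ℝ)⁻¹ * (J : ℝ)⁻¹ *
        (∑ i, ‖lam k i - m k‖ ^ 2 + J * ((2 * R) ^ 2 * γ k ^ 2)) + B ^ 2 * γ k ^ 2)
      (fun k => sq_nonneg _)
      (fun k => by
        have := hγ0 k
        positivity)
      (fun k => by positivity)
      (((hcons.add ((hγsq.mul_left _).mul_left _)).mul_left _).add (hγsq.mul_left _)) fun k => ?_
    have hexp : ‖m (k + 1) - lamstar‖ ^ 2 = ‖m k - lamstar‖ ^ 2 -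
        2 * γ k * ⟪m k - lamstar, agentMean (d k)⟫_ℝ + γ k ^ 2 * ‖agentMean (d k)‖ ^ 2 := by
      rw [hmean, sub_right_comm, norm_sub_sq_real, real_inner_smul_right, norm_smul, mul_pow,
        Real.norm_eq_abs, sq_abs]
      ring
    have hsum := sum_le_sum fun i (_ : i ∈ univ) => hlocal k i
    rw [← mul_sum, sum_add_distrib, ← mul_sum, ← inner_sum, sum_add_distrib, sum_const,
      card_univ, Fintype.card_fin, nsmul_eq_mul] at hsum
    have hscaled := mul_le_mul_of_nonneg_left hsum
      (by positivity : (0 : ℝ) ≤ (J : ℝ)⁻¹ * (J : ℝ)⁻¹)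
    have hDsq : γ k ^ 2 * ‖agentMean (d k)‖ ^ 2 ≤ γ k ^ 2 * B ^ 2 := by
      gcongr
      exact hmeanB k
    have hinner : ⟪m k - lamstar, agentMean (d k)⟫_ℝ = (J : ℝ)⁻¹ * (J : ℝ)⁻¹ *
        ⟪m k - lamstar, ∑ i, (Θstar i - θv k i)⟫_ℝ := by
      rw [hmeand, real_inner_smul_right]
    rw [hexp, hinner]
    linarith
  -- comparison with the responses to the average multiplier
  set p : ℕ → Fin J → EuclideanSpace ℝ (Fin D) := fun k i => prox i (m k) with hp
  have hpC : ∀ k i, p k i ∈ C i := fun k i => (hmin i _).1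
  have hpθ : ∀ k i, ‖p k i - θv k i‖ ≤ 2 / uf * ‖lam k i - m k‖ := by
    intro k i
    rw [hθ, norm_sub_rev (lam k i)]
    exact (hmin i _).norm_sub_le huf (hfsc i) (hCcvx i) (hmin i _)
  have htri : ∀ x y z : EuclideanSpace ℝ (Fin D),
      ‖x - z‖ ^ 2 ≤ 2 * ‖y - z‖ ^ 2 + 2 * ‖x - y‖ ^ 2 := by
    intro x y z
    have h := pow_le_pow_left₀ (norm_nonneg _) (norm_sub_le_norm_sub_add_norm_sub x y z) 2
    nlinarith [sq_nonneg (‖x - y‖ - ‖y - z‖)]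
  have hpθsq : ∀ k i, ‖p k i - θv k i‖ ^ 2 ≤ (2 / uf) ^ 2 * ‖lam k i - m k‖ ^ 2 := by
    intro k i
    rw [← mul_pow]
    exact pow_le_pow_left₀ (norm_nonneg _) (hpθ k i) 2
  have hb : Tendsto (fun k => ∑ i, ‖p k i - Θstar i‖ ^ 2) atTop (𝓝 0) := by
    refine tendsto_zero_of_summable_mul (γ := γ) (c := J * (2 / uf * B * (4 * R)))
      (by positivity) (fun k => sum_nonneg fun i _ => sq_nonneg _) hγ0 hγns hγsq ?_ ?_
    · obtain ⟨G, hG⟩ := hγsq.tendsto_atTop_zero.bddAbove_range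
      have hγle : ∀ k, γ k ≤ 1 + G := fun k => by
        have : γ k ^ 2 ≤ G := hG ⟨k, rfl⟩
        nlinarith [sq_nonneg (γ k - 1), hγ0 k]
      refine Summable.of_nonneg_of_le
        (fun k => mul_nonneg (hγ0 k) (sum_nonneg fun i _ => sq_nonneg _)) (fun k => ?_)
        ((hγθ.mul_left 2).add (hcons.mul_left ((1 + G) * (2 * (2 / uf) ^ 2))))
      have h1 : ∑ i, ‖p k i - Θstar i‖ ^ 2 ≤ 2 * ∑ i, ‖θv k i - Θstar i‖ ^ 2 +
          2 * (2 / uf) ^ 2 * ∑ i, ‖lam k i - m k‖ ^ 2 := by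
        rw [mul_sum, mul_sum, ← sum_add_distrib]
        refine sum_le_sum fun i _ => ?_
        linarith [htri (p k i) (θv k i) (Θstar i), hpθsq k i]
      have h2 := mul_le_mul_of_nonneg_left h1 (hγ0 k)
      have h3 : γ k * (2 * (2 / uf) ^ 2 * ∑ i, ‖lam k i - m k‖ ^ 2) ≤
          (1 + G) * (2 * (2 / uf) ^ 2 * ∑ i, ‖lam k i - m k‖ ^ 2) := by
        gcongr
        exact hγle k
      linarith
    · intro k
      have hterm : ∀ i, ‖p (k + 1) i - Θstar i‖ ^ 2 ≤
          ‖p k i - Θstar i‖ ^ 2 + 2 / uf * B * (4 * R) * γ k := by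
        intro i
        have h1 : ‖p (k + 1) i - p k i‖ ≤ 2 / uf * (γ k * B) := by
          refine ((hmin i _).norm_sub_le huf (hfsc i) (hCcvx i) (hmin i _)).trans ?_
          rw [hmean, sub_sub_cancel_left, norm_neg, norm_smul, Real.norm_of_nonneg (hγ0 k)]
          have := hγ0 k
          gcongr
          exact hmeanB k
        have h2 := norm_sub_le_norm_sub_add_norm_sub (p (k + 1) i) (p k i) (Θstar i)
        have h3 := hdiff i _ (hpC k i) _ (hΘfeas.1 i)
        have h4 := hdiff i _ (hpC (k + 1) i) _ (hΘfeas.1 i)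
        have h5 : (‖p (k + 1) i - Θstar i‖ - ‖p k i - Θstar i‖) *
            (‖p (k + 1) i - Θstar i‖ + ‖p k i - Θstar i‖) ≤ 2 / uf * (γ k * B) * (4 * R) := by
          have := hγ0 k
          refine mul_le_mul (by linarith) (by linarith) (by positivity) (by positivity)
        linarith
      refine (sum_le_sum fun i _ => hterm i).trans (le_of_eq ?_)
      rw [sum_add_distrib, sum_const, card_univ, Fintype.card_fin, nsmul_eq_mul]
      ring
  have hθlim : Tendsto (fun k => ∑ i, ‖θv k i - Θstar i‖ ^ 2) atTop (𝓝 0) := by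
    have hup : Tendsto (fun k => 2 * ∑ i, ‖p k i - Θstar i‖ ^ 2 +
        2 * (2 / uf) ^ 2 * ∑ i, ‖lam k i - m k‖ ^ 2) atTop (𝓝 0) := by
      simpa using (hb.const_mul 2).add
        (hcons.tendsto_atTop_zero.const_mul (2 * (2 / uf) ^ 2))
    refine squeeze_zero (fun k => sum_nonneg fun i _ => sq_nonneg _) (fun k => ?_) hup
    rw [mul_sum, mul_sum, ← sum_add_distrib]
    refine sum_le_sum fun i _ => ?_
    have := htri (θv k i) (p k i) (Θstar i)
    rw [norm_sub_rev (θv k i) (p k i)] at this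
    linarith [hpθsq k i]
  have := (Real.continuous_sqrt.tendsto 0).comp ((tendsto_add_atTop_iff_nat 1).2 hθlim)
  rw [Real.sqrt_zero] at this
  exact this
end

section
/- Under the Byzantine setting, suppose ρ < (1−κ)/(8√H) (so ε := 1−κ−8ρ√H > 0), and use the decreasing step size γ^k = 4/(β(H/J)(k₀+k)) with integer k₀ ≥ max{2/(αβ), √(216(3−ε)/((2−ε)ε u_f²H²β²)), 1/(√(2/(2−ε²))−1), 8√3/(u_f Hβ)}. Then the honest dual iterates reach consensus: lim_{k→∞} ∑_{i∈𝓗} ‖λ_i^{k+1} − λ̄^{k+1}‖ = 0, where λ̄^{k+1} := (1/H)∑_{i∈𝓗} λ_i^{k+1}. -/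
open Filter Finset
open scoped BigOperators Topology InnerProductSpace

/-- The family of deviations of the vectors `x i` from their mean, with the `ℓ²` norm. -/
noncomputable def meanDeviation {n : ℕ} {V : Type*} [NormedAddCommGroup V] [NormedSpace ℝ V]
    (x : Fin n → V) : PiLp 2 (fun _ : Fin n => V) :=
  WithLp.toLp 2 (fun i => x i - (n : ℝ)⁻¹ • ∑ j, x j)

section MeanDeviation

variable {n : ℕ} {V : Type*} [NormedAddCommGroup V] [NormedSpace ℝ V]

theorem meanDeviation_apply (x : Fin n → V) (i : Fin n) :
    meanDeviation x i = x i - (n : ℝ)⁻¹ • ∑ j, x j := rfl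

theorem meanDeviation_add (x y : Fin n → V) :
    meanDeviation (x + y) = meanDeviation x + meanDeviation y := by
  ext i
  simp only [meanDeviation_apply, PiLp.add_apply, Pi.add_apply, Finset.sum_add_distrib, smul_add]
  abel

theorem meanDeviation_smul (c : ℝ) (x : Fin n → V) :
    meanDeviation (c • x) = c • meanDeviation x := by
  ext i
  simp only [meanDeviation_apply, PiLp.smul_apply, Pi.smul_apply, ← Finset.smul_sum, smul_sub,
    smul_comm c]

theorem norm_sub_le_two_mul_norm_meanDeviation (x : Fin n → V) (i j : Fin n) :
    ‖x i - x j‖ ≤ 2 * ‖meanDeviation x‖ := by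
  have h : x i - x j = meanDeviation x i - meanDeviation x j := by
    simp only [meanDeviation_apply]; abel
  rw [h]
  linarith [norm_sub_le (meanDeviation x i) (meanDeviation x j),
    PiLp.norm_apply_le (meanDeviation x) i, PiLp.norm_apply_le (meanDeviation x) j]

theorem norm_meanDeviation_le (x : Fin n → V) {W : ℝ} (hW : ∀ i, ‖x i‖ ≤ W) :
    ‖meanDeviation x‖ ≤ √n * (2 * W) := by
  rcases Nat.eq_zero_or_pos n with rfl | hn
  · simp [PiLp.norm_eq_of_L2]
  have hn' : (0 : ℝ) < n := by exact_mod_cast hn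
  have hW0 : 0 ≤ W := (norm_nonneg _).trans (hW ⟨0, hn⟩)
  have hmean : ‖(n : ℝ)⁻¹ • ∑ j, x j‖ ≤ W := by
    rw [norm_smul, norm_inv, Real.norm_natCast, inv_mul_le_iff₀ hn']
    simpa using norm_sum_le_of_le univ (fun j _ => hW j)
  have hi : ∀ i, ‖meanDeviation x i‖ ≤ 2 * W := fun i => by
    rw [meanDeviation_apply]
    linarith [norm_sub_le (x i) ((n : ℝ)⁻¹ • ∑ j, x j), hW i]
  rw [PiLp.norm_eq_of_L2, ← Real.sqrt_sq (by positivity : 0 ≤ 2 * W), ← Real.sqrt_mul hn'.le]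
  refine Real.sqrt_le_sqrt ?_
  calc ∑ i, ‖meanDeviation x i‖ ^ 2 ≤ ∑ _i : Fin n, (2 * W) ^ 2 :=
        Finset.sum_le_sum fun i _ => pow_le_pow_left₀ (norm_nonneg _) (hi i) 2
    _ = n * (2 * W) ^ 2 := by simp

theorem norm_sub_sum_smul_le (x : Fin n → V) {w : Fin n → ℝ} (hw : ∀ j, 0 ≤ w j)
    (hsum : ∑ j, w j = 1) (i : Fin n) :
    ‖x i - ∑ j, w j • x j‖ ≤ 2 * ‖meanDeviation x‖ := by
  have h : x i - ∑ j, w j • x j = ∑ j, w j • (x i - x j) := by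
    simp only [smul_sub, Finset.sum_sub_distrib, ← Finset.sum_smul, hsum, one_smul]
  calc ‖x i - ∑ j, w j • x j‖ ≤ ∑ j, w j * (2 * ‖meanDeviation x‖) := by
        rw [h]
        refine norm_sum_le_of_le _ fun j _ => ?_
        rw [norm_smul, Real.norm_of_nonneg (hw j)]
        exact mul_le_mul_of_nonneg_left (norm_sub_le_two_mul_norm_meanDeviation x i j) (hw j)
    _ = 2 * ‖meanDeviation x‖ := by rw [← Finset.sum_mul, hsum, one_mul]

end MeanDeviation

/-- The operator norm of a matrix bounds its action on families of Euclidean vectors. -/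
theorem norm_toLp_sum_smul_le {n D : ℕ} (M : Matrix (Fin n) (Fin n) ℝ)
    (x : Fin n → EuclideanSpace ℝ (Fin D)) :
    ‖(WithLp.toLp 2 fun i => ∑ j, M i j • x j : PiLp 2 fun _ : Fin n => EuclideanSpace ℝ (Fin D))‖ ≤
      ‖LinearMap.toContinuousLinearMap (Matrix.toEuclideanLin M)‖ *
        ‖(WithLp.toLp 2 x : PiLp 2 fun _ : Fin n => EuclideanSpace ℝ (Fin D))‖ := by
  set T := LinearMap.toContinuousLinearMap (Matrix.toEuclideanLin M)
  have hcol : ∀ d, ∑ i, (∑ j, M i j * x j d) ^ 2 ≤ ‖T‖ ^ 2 * ∑ i, x i d ^ 2 := fun d => by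
    have h := pow_le_pow_left₀ (norm_nonneg _)
      (T.le_opNorm (WithLp.toLp 2 fun i => x i d)) 2
    rw [mul_pow, EuclideanSpace.norm_sq_eq, EuclideanSpace.norm_sq_eq] at h
    simpa [T, Matrix.toLpLin_apply, Matrix.mulVec, dotProduct] using h
  refine le_of_sq_le_sq ?_ (by positivity)
  rw [mul_pow, PiLp.norm_sq_eq_of_L2, PiLp.norm_sq_eq_of_L2]
  simp only [EuclideanSpace.norm_sq_eq, Real.norm_eq_abs, sq_abs, WithLp.ofLp_sum,
    WithLp.ofLp_smul, Finset.sum_apply, Pi.smul_apply, smul_eq_mul]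
  calc _ = ∑ d, ∑ i, (∑ j, M i j * x j d) ^ 2 := Finset.sum_comm
    _ ≤ ∑ d, ‖T‖ ^ 2 * ∑ i, x i d ^ 2 := Finset.sum_le_sum fun d _ => hcol d
    _ = _ := by rw [← Finset.mul_sum, Finset.sum_comm]

/-- Mixing by a row-stochastic matrix contracts deviations from the mean. -/
theorem norm_meanDeviation_sum_smul_le {n D : ℕ} (E : Matrix (Fin n) (Fin n) ℝ)
    (hE : ∀ i, ∑ j, E i j = 1) (x : Fin n → EuclideanSpace ℝ (Fin D)) :
    ‖meanDeviation fun i => ∑ j, E i j • x j‖ ≤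
      ‖LinearMap.toContinuousLinearMap (Matrix.toEuclideanLin
        (E - (Matrix.of fun _ _ => (n : ℝ)⁻¹ : Matrix (Fin n) (Fin n) ℝ) * E))‖ *
        ‖meanDeviation x‖ := by
  rcases Nat.eq_zero_or_pos n with rfl | hn
  · simp [PiLp.norm_eq_of_L2]
  have hn' : (n : ℝ) ≠ 0 := by exact_mod_cast hn.ne'
  set M := E - (Matrix.of fun _ _ => (n : ℝ)⁻¹ : Matrix (Fin n) (Fin n) ℝ) * E with hM
  have hMij : ∀ i j, M i j = E i j - (n : ℝ)⁻¹ * ∑ l, E l j := fun i j => by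
    simp [hM, Matrix.mul_apply, Finset.mul_sum]
  have hrow : ∀ i, ∑ j, M i j = 0 := fun i => by
    simp only [hMij, Finset.sum_sub_distrib, ← Finset.mul_sum, hE]
    rw [Finset.sum_comm]
    simp [hE, hn']
  have hkey : (meanDeviation fun i => ∑ j, E i j • x j) =
      WithLp.toLp 2 fun i => ∑ j, M i j • (x j - (n : ℝ)⁻¹ • ∑ l, x l) := by
    refine WithLp.ofLp_injective 2 (funext fun i => ?_)
    change _ - _ = ∑ j, M i j • (x j - (n : ℝ)⁻¹ • ∑ l, x l)
    simp only [smul_sub, Finset.sum_sub_distrib, ← Finset.sum_smul, hrow, zero_smul, sub_zero]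
    simp only [hMij, sub_smul, Finset.sum_sub_distrib, mul_smul, Finset.sum_smul,
      ← Finset.smul_sum]
    rw [Finset.sum_comm]
  rw [hkey]
  exact norm_toLp_sum_smul_le M _

/-- A nonnegative sequence driven by a contraction and a vanishing perturbation vanishes. -/
theorem tendsto_zero_of_le_mul_add {a b : ℕ → ℝ} {c : ℝ} (ha : ∀ k, 0 ≤ a k) (hc0 : 0 ≤ c)
    (hc1 : c < 1) (hb : Tendsto b atTop (𝓝 0)) (h : ∀ k, a (k + 1) ≤ c * a k + b k) :
    Tendsto a atTop (𝓝 0) := by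
  rw [Metric.tendsto_atTop]
  intro e he
  obtain ⟨N, hN⟩ := Metric.tendsto_atTop.1 hb ((1 - c) * (e / 2)) (by nlinarith)
  have hind : ∀ k, a (N + k) ≤ e / 2 + c ^ k * a N := by
    intro k
    induction k with
    | zero => simp; linarith
    | succ k ih =>
      have hbk : b (N + k) ≤ (1 - c) * (e / 2) := by
        have := hN (N + k) (by omega)
        rw [Real.dist_0_eq_abs] at this
        exact (le_abs_self _).trans this.le
      calc a (N + (k + 1)) ≤ c * a (N + k) + b (N + k) := h (N + k)
        _ ≤ c * (e / 2 + c ^ k * a N) + (1 - c) * (e / 2) := by gcongr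
        _ = e / 2 + c ^ (k + 1) * a N := by ring
  have hpow : Tendsto (fun k => c ^ k * a N) atTop (𝓝 0) := by
    simpa using (tendsto_pow_atTop_nhds_zero_of_lt_one hc0 hc1).mul_const (a N)
  obtain ⟨K, hK⟩ := eventually_atTop.1 (hpow.eventually_lt_const (half_pos he))
  refine ⟨N + K, fun k hk => ?_⟩
  obtain ⟨m, rfl⟩ : ∃ m, k = N + m := ⟨k - N, by omega⟩
  rw [Real.dist_0_eq_abs, abs_of_nonneg (ha _)]
  linarith [hind m, hK m (by omega)]

theorem statement_3
    (D H J : ℕ) (hH : 0 < H) (hHJ : H ≤ J)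
    (uf Lf : ℝ) (huf : 0 < uf) (hufLf : uf ≤ Lf)
    (f : Fin H → EuclideanSpace ℝ (Fin D) → ℝ)
    (C : Fin H → Set (EuclideanSpace ℝ (Fin D)))
    (hCne : ∀ i, (C i).Nonempty)
    (hCcpt : ∀ i, IsCompact (C i))
    (hCcvx : ∀ i, Convex ℝ (C i))
    (hfsc : ∀ i, StrongConvexOn Set.univ uf (f i))
    (hfdiff : ∀ i, Differentiable ℝ (f i))
    (hfsm : ∀ i x y, ‖gradient (f i) x - gradient (f i) y‖ ≤ Lf * ‖x - y‖)
    (s : EuclideanSpace ℝ (Fin D))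
    -- `prox i lam` is the minimizer of `θ ↦ ⟪lam, θ⟫ + f i θ` over `C i`
    (prox : Fin H → EuclideanSpace ℝ (Fin D) → EuclideanSpace ℝ (Fin D))
    (hprox : ∀ i lam, prox i lam ∈ C i ∧
      ∀ θ ∈ C i, ⟪lam, prox i lam⟫_ℝ + f i (prox i lam) ≤ ⟪lam, θ⟫_ℝ + f i θ)
    -- conjugate functions and local dual functions of the honest agents
    (Fstar : Fin H → EuclideanSpace ℝ (Fin D) → ℝ)
    (hFstar : ∀ i lam, Fstar i lam = sSup ((fun θ => ⟪lam, θ⟫_ℝ - f i θ) '' C i))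
    (g : Fin H → EuclideanSpace ℝ (Fin D) → ℝ)
    (hgdef : ∀ i lam, g i lam = (H : ℝ)⁻¹ * Fstar i (-lam) + (H : ℝ)⁻¹ * ⟪lam, s⟫_ℝ)
    -- gradients of the local dual functions
    (gradg : Fin H → EuclideanSpace ℝ (Fin D) → EuclideanSpace ℝ (Fin D))
    (hgradg : ∀ i lam, gradg i lam = (H : ℝ)⁻¹ • s - (H : ℝ)⁻¹ • prox i lam)
    -- uniform bound on the deviation of the local dual gradients
    (δ : ℝ) (hδ0 : 0 ≤ δ)
    (hδ : ∀ (lam : EuclideanSpace ℝ (Fin D)) (i : Fin H),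
      ‖gradg i lam - (H : ℝ)⁻¹ • ∑ j, gradg j lam‖ ^ 2 ≤ δ ^ 2)
    -- Definition 1: robust aggregation with contraction constant ρ and
    -- row-stochastic virtual weight matrix Evw supported on honest neighborhoods
    (ρ : ℝ) (hρ0 : 0 ≤ ρ)
    (Nb : Fin H → Finset (Fin H)) (hself : ∀ i, i ∈ Nb i)
    (Evw : Matrix (Fin H) (Fin H) ℝ)
    (hEpos : ∀ i j, j ∈ Nb i → 0 < Evw i j ∧ Evw i j ≤ 1)
    (hEzero : ∀ i j, j ∉ Nb i → Evw i j = 0)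
    (hErow : ∀ i, ∑ j, Evw i j = 1)
    (κ : ℝ)
    (hκ : κ = ‖LinearMap.toContinuousLinearMap (Matrix.toEuclideanLin
        (Evw - (Matrix.of fun _ _ => (H : ℝ)⁻¹ : Matrix (Fin H) (Fin H) ℝ) * Evw))‖ ^ 2)
    (hκlt : κ < 1)
    (χsq : ℝ) (hχ : χsq = (H : ℝ)⁻¹ * ∑ j, ((∑ i, Evw i j) - 1) ^ 2)
    (ε : ℝ) (hε : ε = 1 - κ - 8 * ρ * Real.sqrt (H : ℝ))
    (hρκ : ρ < (1 - κ) / (8 * Real.sqrt (H : ℝ)))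
    -- constants α, β
    (α β : ℝ)
    (hα : α = H * uf * Lf / (uf + Lf))
    (hβ : β = 1 / (H * (uf + Lf)))
    -- the step size
    (k₀ : ℕ)
    (hk₀ : max (max (2 / (α * β))
          (Real.sqrt (216 * (3 - ε) / ((2 - ε) * ε * uf ^ 2 * (H : ℝ) ^ 2 * β ^ 2))))
        (max (1 / (Real.sqrt (2 / (2 - ε ^ 2)) - 1)) (8 * Real.sqrt 3 / (uf * H * β)))
      ≤ (k₀ : ℝ))
    (γ : ℕ → ℝ) (hγ : ∀ k, γ k = 4 / (β * ((H : ℝ) / (J : ℝ)) * ((k₀ : ℝ) + (k : ℝ))))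
    -- the Byzantine-resilient decentralized resource allocation algorithm
    (lam lamh θv : ℕ → Fin H → EuclideanSpace ℝ (Fin D))
    (lam0 : EuclideanSpace ℝ (Fin D)) (hinit : ∀ i, lam 0 i = lam0)
    (hθ : ∀ k i, θv k i = prox i (lam k i))
    (hhalf : ∀ k i, lamh k i = lam k i - γ k • ((J : ℝ)⁻¹ • s - (J : ℝ)⁻¹ • θv k i))
    -- the aggregated iterate is ρ-close to the virtual weighted average
    (hagg : ∀ k i, ‖lam (k + 1) i - ∑ j, Evw i j • lamh k j‖ ≤
      ρ * (Nb i).sup' ⟨i, hself i⟩ (fun j => ‖lamh k j - ∑ j', Evw i j' • lamh k j'‖))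
    :
    Tendsto (fun k => ∑ i, ‖lam (k + 1) i - (H : ℝ)⁻¹ • ∑ j, lam (k + 1) j‖) atTop (𝓝 0) := by
  set q := ‖LinearMap.toContinuousLinearMap (Matrix.toEuclideanLin
        (Evw - (Matrix.of fun _ _ => (H : ℝ)⁻¹ : Matrix (Fin H) (Fin H) ℝ) * Evw))‖
  have hH' : (0 : ℝ) < H := by exact_mod_cast hH
  have hq0 : 0 ≤ q := norm_nonneg _
  have hq1 : q < 1 := by nlinarith
  have hE0 : ∀ i j, 0 ≤ Evw i j := fun i j => by
    by_cases hj : j ∈ Nb i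
    · exact (hEpos i j hj).1.le
    · exact (hEzero i j hj).ge
  have hcontr : q + 4 * ρ * √H < 1 := by
    have h := (lt_div_iff₀ (by positivity)).1 hρκ
    nlinarith
  have hβ0 : 0 < β := by rw [hβ]; have := huf.trans_le hufLf; positivity
  have hJ' : (0 : ℝ) < J := hH'.trans_le (by exact_mod_cast hHJ)
  have hγ0 : Tendsto γ atTop (𝓝 0) := by
    simp only [funext hγ]
    refine Tendsto.const_div_atTop ?_ 4
    exact (tendsto_atTop_add_const_left _ _ tendsto_natCast_atTop_atTop).const_mul_atTop
      (by positivity)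
  obtain ⟨W, hW⟩ : ∃ W, ∀ k i, ‖(J : ℝ)⁻¹ • θv k i - (J : ℝ)⁻¹ • s‖ ≤ W := by
    have hbdd : Bornology.IsBounded (⋃ i, C i) :=
      (Bornology.isBounded_iUnion).2 fun i => (hCcpt i).isBounded
    obtain ⟨R, hR⟩ := hbdd.exists_norm_le
    refine ⟨(J : ℝ)⁻¹ * R + ‖(J : ℝ)⁻¹ • s‖, fun k i => (norm_sub_le _ _).trans ?_⟩
    have hθR : ‖θv k i‖ ≤ R := by
      rw [hθ]; exact hR _ (Set.mem_iUnion.2 ⟨i, (hprox i _).1⟩)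
    rw [norm_smul, norm_inv, Real.norm_natCast]
    gcongr
  have hdevhalf : ∀ k, ‖meanDeviation (lamh k)‖ ≤
      ‖meanDeviation (lam k)‖ + |γ k| * (√H * (2 * W)) := fun k => by
    have h : lamh k = lam k + γ k • fun i => (J : ℝ)⁻¹ • θv k i - (J : ℝ)⁻¹ • s := by
      funext i
      simp only [hhalf, Pi.add_apply, Pi.smul_apply, smul_sub]
      abel
    rw [h, meanDeviation_add, meanDeviation_smul]
    refine (norm_add_le _ _).trans ?_
    rw [norm_smul, Real.norm_eq_abs]
    gcongr
    exact norm_meanDeviation_le _ (hW k)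
  have hdevagg : ∀ k, ‖meanDeviation (lam (k + 1))‖ ≤
      (q + 4 * ρ * √H) * ‖meanDeviation (lamh k)‖ := fun k => by
    set y : Fin H → EuclideanSpace ℝ (Fin D) := fun i => ∑ j, Evw i j • lamh k j
    have hy : ‖meanDeviation y‖ ≤ q * ‖meanDeviation (lamh k)‖ :=
      norm_meanDeviation_sum_smul_le Evw hErow (lamh k)
    have herr : ‖meanDeviation (lam (k + 1) - y)‖ ≤
        √H * (2 * (ρ * (2 * ‖meanDeviation (lamh k)‖))) :=
      norm_meanDeviation_le _ fun i => (hagg k i).trans <|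
        mul_le_mul_of_nonneg_left (Finset.sup'_le _ _ fun j _ =>
          norm_sub_sum_smul_le (lamh k) (hE0 i) (hErow i) j) hρ0
    calc ‖meanDeviation (lam (k + 1))‖ = ‖meanDeviation (y + (lam (k + 1) - y))‖ := by
          rw [add_sub_cancel]
      _ ≤ ‖meanDeviation y‖ + ‖meanDeviation (lam (k + 1) - y)‖ := by
          rw [meanDeviation_add]; exact norm_add_le _ _
      _ ≤ (q + 4 * ρ * √H) * ‖meanDeviation (lamh k)‖ := by linarith
  have hc0 : 0 ≤ q + 4 * ρ * √H := by positivity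
  have hlim : Tendsto (fun k => ‖meanDeviation (lam k)‖) atTop (𝓝 0) := by
    refine tendsto_zero_of_le_mul_add (c := q + 4 * ρ * √H)
      (b := fun k => (q + 4 * ρ * √H) * (|γ k| * (√H * (2 * W))))
      (fun k => norm_nonneg _) hc0 hcontr ?_ fun k => ?_
    · simpa using ((hγ0.abs).mul_const (√H * (2 * W))).const_mul (q + 4 * ρ * √H)
    · rw [← mul_add]
      exact (hdevagg k).trans (mul_le_mul_of_nonneg_left (hdevhalf k) hc0)
  refine squeeze_zero (fun k => Finset.sum_nonneg fun i _ => norm_nonneg _)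
    (g := fun k => H * ‖meanDeviation (lam (k + 1))‖) (fun k => ?_) ?_
  · simpa using Finset.sum_le_card_nsmul univ
      (fun i => ‖lam (k + 1) i - (H : ℝ)⁻¹ • ∑ j, lam (k + 1) j‖) _
      fun i _ => PiLp.norm_apply_le (meanDeviation (lam (k + 1))) i
  · simpa using ((tendsto_add_atTop_iff_nat 1).2 hlim).const_mul (H : ℝ)
end

section
/- Let Λ^k ∈ ℝ^{H×D} stack the honest dual iterates (λ_i^k)_{i∈𝓗} and Λ^{k+1/2} stack the half-step iterates λ_i^{k+1/2} = λ_i^k − γ^k(s/J − θ_i^k/J). Then for every constant v ∈ (0,1): ‖Λ^{k+1/2} − (1/H)11ᵀΛ^{k+1/2}‖_F² ≤ (1/(1−v) + 6(γ^k)²/(v·u_f²J²))·‖Λ^k − (1/H)11ᵀΛ^k‖_F² + 3(γ^k)²δ²H³/(v·J²). -/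
open Filter Finset
open scoped BigOperators Topology InnerProductSpace

section

variable {E : Type*} [NormedAddCommGroup E] [InnerProductSpace ℝ E]

theorem strongConvex_growth_of_isMinOn {g : E → ℝ} {u : ℝ}
    (hg : StrongConvexOn Set.univ u g) {C : Set E} (hC : Convex ℝ C) {p x : E} (hp : p ∈ C)
    (hmin : ∀ θ ∈ C, g p ≤ g θ) (hx : x ∈ C) :
    g p + u / 2 * ‖p - x‖ ^ 2 ≤ g x := by
  have key : ∀ t : ℝ, 0 < t → t < 1 → (1 - t) * (u / 2 * ‖p - x‖ ^ 2) ≤ g x - g p := by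
    intro t ht ht1
    have h := hg.2 (Set.mem_univ p) (Set.mem_univ x) (sub_nonneg.2 ht1.le) ht.le (by ring)
    have h' := hmin _ (hC hp hx (sub_nonneg.2 ht1.le) ht.le (by ring))
    simp only [smul_eq_mul] at h
    refine le_of_mul_le_mul_left ?_ ht
    linarith
  have hM : 0 ≤ g x - g p := sub_nonneg.2 (hmin x hx)
  generalize u / 2 * ‖p - x‖ ^ 2 = K at key ⊢
  by_contra! hlt
  have hK : 0 < K := by linarith
  have h := key ((K - (g x - g p)) / (2 * K)) (div_pos (by linarith) (by linarith))
    ((div_lt_one (by linarith)).2 (by linarith))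
  have e : (1 - (K - (g x - g p)) / (2 * K)) * K = (K + (g x - g p)) / 2 := by
    field_simp
    ring
  linarith

theorem strongConvexOn_inner_add {f : E → ℝ} {u : ℝ} (hf : StrongConvexOn Set.univ u f) (a : E) :
    StrongConvexOn Set.univ u (fun θ => ⟪a, θ⟫_ℝ + f θ) := by
  refine ⟨hf.1, fun x hx y hy s t hs ht hst => ?_⟩
  have h := hf.2 hx hy hs ht hst
  simp only [smul_eq_mul, inner_add_right, inner_smul_right] at h ⊢
  linarith

theorem norm_argmin_sub_argmin_le {f : E → ℝ} {u : ℝ}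
    (hf : StrongConvexOn Set.univ u f) {C : Set E} (hC : Convex ℝ C) {a b p q : E}
    (hp : p ∈ C) (hpmin : ∀ θ ∈ C, ⟪a, p⟫_ℝ + f p ≤ ⟪a, θ⟫_ℝ + f θ)
    (hq : q ∈ C) (hqmin : ∀ θ ∈ C, ⟪b, q⟫_ℝ + f q ≤ ⟪b, θ⟫_ℝ + f θ) :
    u * ‖p - q‖ ≤ ‖a - b‖ := by
  have h1 := strongConvex_growth_of_isMinOn (strongConvexOn_inner_add hf a) hC hp hpmin hq
  have h2 := strongConvex_growth_of_isMinOn (strongConvexOn_inner_add hf b) hC hq hqmin hp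
  rw [norm_sub_rev q p] at h2
  have h3 := neg_le_of_abs_le (abs_real_inner_le_norm (a - b) (p - q))
  simp only [inner_sub_left, inner_sub_right] at h3
  rcases (norm_nonneg (p - q)).eq_or_lt with h0 | h0
  · rw [← h0, mul_zero]
    exact norm_nonneg _
  · refine le_of_mul_le_mul_right ?_ h0
    nlinarith

theorem sum_norm_sub_mean_sq_le {ι : Type*} [Fintype ι] (x : ι → E) :
    ∑ i, ‖x i - (Fintype.card ι : ℝ)⁻¹ • ∑ j, x j‖ ^ 2 ≤ ∑ i, ‖x i‖ ^ 2 := by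
  rcases isEmpty_or_nonempty ι with h | h
  · simp
  have hn : (0 : ℝ) < Fintype.card ι := by exact_mod_cast Fintype.card_pos
  simp only [norm_sub_sq_real, Finset.sum_add_distrib, Finset.sum_sub_distrib, ← Finset.mul_sum,
    ← sum_inner, Finset.sum_const, Finset.card_univ, nsmul_eq_mul, inner_smul_right,
    real_inner_self_eq_norm_sq, norm_smul, mul_pow, norm_inv, Real.norm_natCast]
  have e : (Fintype.card ι : ℝ) * ((Fintype.card ι : ℝ)⁻¹ ^ 2 * ‖∑ j, x j‖ ^ 2) =
      (Fintype.card ι : ℝ)⁻¹ * ‖∑ j, x j‖ ^ 2 := by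
    field_simp
  have : 0 ≤ (Fintype.card ι : ℝ)⁻¹ * ‖∑ j, x j‖ ^ 2 := by positivity
  linarith

end

theorem norm_add_sq_le_weighted {E : Type*} [SeminormedAddCommGroup E] (x y : E)
    {v : ℝ} (hv : 0 < v) (hv1 : v < 1) :
    ‖x + y‖ ^ 2 ≤ 1 / (1 - v) * ‖x‖ ^ 2 + 1 / v * ‖y‖ ^ 2 := by
  have hw : 0 < 1 - v := sub_pos.2 hv1
  have h : ‖x + y‖ ^ 2 ≤ (‖x‖ + ‖y‖) ^ 2 := by
    gcongr
    exact norm_add_le x y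
  have e : 1 / (1 - v) * ‖x‖ ^ 2 + 1 / v * ‖y‖ ^ 2 - (‖x‖ + ‖y‖) ^ 2 =
      (v * ‖x‖ - (1 - v) * ‖y‖) ^ 2 / ((1 - v) * v) := by
    field_simp
    ring
  have : 0 ≤ (v * ‖x‖ - (1 - v) * ‖y‖) ^ 2 / ((1 - v) * v) := by positivity
  linarith

theorem statement_7
    (D H J : ℕ) (hH : 0 < H) (hHJ : H ≤ J)
    (uf Lf : ℝ) (huf : 0 < uf) (hufLf : uf ≤ Lf)
    (f : Fin H → EuclideanSpace ℝ (Fin D) → ℝ)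
    (C : Fin H → Set (EuclideanSpace ℝ (Fin D)))
    (hCne : ∀ i, (C i).Nonempty)
    (hCcpt : ∀ i, IsCompact (C i))
    (hCcvx : ∀ i, Convex ℝ (C i))
    (hfsc : ∀ i, StrongConvexOn Set.univ uf (f i))
    (hfdiff : ∀ i, Differentiable ℝ (f i))
    (hfsm : ∀ i x y, ‖gradient (f i) x - gradient (f i) y‖ ≤ Lf * ‖x - y‖)
    (s : EuclideanSpace ℝ (Fin D))
    -- `prox i lam` is the minimizer of `θ ↦ ⟪lam, θ⟫ + f i θ` over `C i`
    (prox : Fin H → EuclideanSpace ℝ (Fin D) → EuclideanSpace ℝ (Fin D))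
    (hprox : ∀ i lam, prox i lam ∈ C i ∧
      ∀ θ ∈ C i, ⟪lam, prox i lam⟫_ℝ + f i (prox i lam) ≤ ⟪lam, θ⟫_ℝ + f i θ)
    -- gradients of the local dual functions
    (gradg : Fin H → EuclideanSpace ℝ (Fin D) → EuclideanSpace ℝ (Fin D))
    (hgradg : ∀ i lam, gradg i lam = (H : ℝ)⁻¹ • s - (H : ℝ)⁻¹ • prox i lam)
    -- uniform bound on the deviation of the local dual gradients
    (δ : ℝ) (hδ0 : 0 ≤ δ)
    (hδ : ∀ (lam : EuclideanSpace ℝ (Fin D)) (i : Fin H),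
      ‖gradg i lam - (H : ℝ)⁻¹ • ∑ j, gradg j lam‖ ^ 2 ≤ δ ^ 2)
    -- one step of the algorithm: current iterates and half-step iterates
    (γ : ℝ) (hγ : 0 < γ)
    (lam lamh θv : Fin H → EuclideanSpace ℝ (Fin D))
    (hθ : ∀ i, θv i = prox i (lam i))
    (hhalf : ∀ i, lamh i = lam i - γ • ((J : ℝ)⁻¹ • s - (J : ℝ)⁻¹ • θv i))
    :
    ∀ v : ℝ, 0 < v → v < 1 →
      ∑ i, ‖lamh i - (H : ℝ)⁻¹ • ∑ j, lamh j‖ ^ 2 ≤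
        (1 / (1 - v) + 6 * γ ^ 2 / (v * uf ^ 2 * (J : ℝ) ^ 2)) *
            ∑ i, ‖lam i - (H : ℝ)⁻¹ • ∑ j, lam j‖ ^ 2 +
          3 * γ ^ 2 * δ ^ 2 * (H : ℝ) ^ 3 / (v * (J : ℝ) ^ 2) := by
  intro v hv hv1
  have hH' : (0 : ℝ) < H := by exact_mod_cast hH
  have hJ' : (0 : ℝ) < J := by exact_mod_cast hH.trans_le hHJ
  set m := (H : ℝ)⁻¹ • ∑ j, lam j with hm
  set q : Fin H → EuclideanSpace ℝ (Fin D) := fun i => prox i m with hq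
  have hmean : ∀ c : EuclideanSpace ℝ (Fin D), (H : ℝ)⁻¹ • ∑ _j : Fin H, c = c := by
    intro c
    rw [Finset.sum_const, Finset.card_univ, Fintype.card_fin, ← Nat.cast_smul_eq_nsmul ℝ,
      smul_smul, inv_mul_cancel₀ hH'.ne', one_smul]
  have hqdev : ∀ i, ‖q i - (H : ℝ)⁻¹ • ∑ j, q j‖ ^ 2 ≤ (H : ℝ) ^ 2 * δ ^ 2 := by
    intro i
    have e : gradg i m - (H : ℝ)⁻¹ • ∑ j, gradg j m =
        -((H : ℝ)⁻¹ • (q i - (H : ℝ)⁻¹ • ∑ j, q j)) := by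
      simp only [hgradg, Finset.sum_sub_distrib, smul_sub, hmean, ← Finset.smul_sum, hq]
      abel
    have h := hδ m i
    rw [e, norm_neg, norm_smul, mul_pow, norm_inv, Real.norm_natCast, inv_pow,
      inv_mul_le_iff₀ (by positivity)] at h
    exact h
  have hlip : ∀ i, ‖θv i - q i‖ ^ 2 ≤ 1 / uf ^ 2 * ‖lam i - m‖ ^ 2 := by
    intro i
    have h := norm_argmin_sub_argmin_le (hfsc i) (hCcvx i) (hprox i (lam i)).1
      (hprox i (lam i)).2 (hprox i m).1 (hprox i m).2
    rw [← hθ] at h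
    rw [one_div, ← div_eq_inv_mul, le_div_iff₀ (by positivity), mul_comm, ← mul_pow]
    gcongr
  have hd := sum_norm_sub_mean_sq_le (fun i => θv i - q i)
  rw [Fintype.card_fin] at hd
  have hθdev : ∀ i, ‖θv i - (H : ℝ)⁻¹ • ∑ j, θv j‖ ^ 2 ≤
      2 * ‖θv i - q i - (H : ℝ)⁻¹ • ∑ j, (θv j - q j)‖ ^ 2 + 2 * ((H : ℝ) ^ 2 * δ ^ 2) := by
    intro i
    have e : θv i - (H : ℝ)⁻¹ • ∑ j, θv j =
        (θv i - q i - (H : ℝ)⁻¹ • ∑ j, (θv j - q j)) + (q i - (H : ℝ)⁻¹ • ∑ j, q j) := by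
      simp only [Finset.sum_sub_distrib, smul_sub]
      abel
    have h := norm_add_sq_le_weighted (θv i - q i - (H : ℝ)⁻¹ • ∑ j, (θv j - q j))
      (q i - (H : ℝ)⁻¹ • ∑ j, q j) (v := 1 / 2) (by norm_num) (by norm_num)
    rw [← e] at h
    rw [show (1 : ℝ) / (1 - 1 / 2) = 2 by norm_num, one_div_one_div] at h
    linarith [hqdev i]
  have hhalfdev : ∀ i, ‖lamh i - (H : ℝ)⁻¹ • ∑ j, lamh j‖ ^ 2 ≤
      1 / (1 - v) * ‖lam i - m‖ ^ 2 +
        1 / v * ((γ / J) ^ 2 * ‖θv i - (H : ℝ)⁻¹ • ∑ j, θv j‖ ^ 2) := by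
    intro i
    have e : lamh i - (H : ℝ)⁻¹ • ∑ j, lamh j =
        (lam i - m) + (γ / J) • (θv i - (H : ℝ)⁻¹ • ∑ j, θv j) := by
      simp only [hhalf, Finset.sum_sub_distrib, smul_sub, hmean, ← Finset.smul_sum, hm,
        div_eq_mul_inv, mul_smul, smul_comm (H : ℝ)⁻¹ γ, smul_comm (H : ℝ)⁻¹ (J : ℝ)⁻¹]
      abel
    have h := norm_add_sq_le_weighted (lam i - m)
      ((γ / J) • (θv i - (H : ℝ)⁻¹ • ∑ j, θv j)) hv hv1
    rw [← e, norm_smul, mul_pow, Real.norm_eq_abs, sq_abs] at h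
    exact h
  have hS := Finset.sum_le_sum fun i (_ : i ∈ Finset.univ) => hhalfdev i
  have hT := Finset.sum_le_sum fun i (_ : i ∈ Finset.univ) => hθdev i
  have hL := Finset.sum_le_sum fun i (_ : i ∈ Finset.univ) => hlip i
  simp only [Finset.sum_add_distrib, ← Finset.mul_sum, Finset.sum_const, Finset.card_univ,
    Fintype.card_fin, nsmul_eq_mul] at hS hT hL
  have hA : 0 ≤ ∑ i, ‖lam i - m‖ ^ 2 := by positivity
  generalize ∑ i, ‖lam i - m‖ ^ 2 = A at *
  have hB : ∑ i, ‖θv i - (H : ℝ)⁻¹ • ∑ j, θv j‖ ^ 2 ≤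
      6 * (1 / uf ^ 2 * A) + 3 * ((H : ℝ) ^ 3 * δ ^ 2) := by
    have h1 : 0 ≤ 1 / uf ^ 2 * A := by positivity
    have h2 : 0 ≤ (H : ℝ) ^ 3 * δ ^ 2 := by positivity
    linarith
  calc ∑ i, ‖lamh i - (H : ℝ)⁻¹ • ∑ j, lamh j‖ ^ 2
      ≤ 1 / (1 - v) * A +
        1 / v * ((γ / J) ^ 2 * ∑ i, ‖θv i - (H : ℝ)⁻¹ • ∑ j, θv j‖ ^ 2) := hS
    _ ≤ 1 / (1 - v) * A +
        1 / v * ((γ / J) ^ 2 * (6 * (1 / uf ^ 2 * A) + 3 * ((H : ℝ) ^ 3 * δ ^ 2))) := by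
      gcongr
    _ = _ := by
      rw [add_mul, add_assoc]
      congr 1
      field_simp
end

section
/- Let ψ₁ ∈ (0,1) and ψ₂ ≥ 0, and let (γ^k)_{k≥0} be a sequence of positive reals satisfying 1 ≤ (γ^k)²/(γ^{k+1})² ≤ 2/(1+ψ₁) for every integer k ≥ 0. If a sequence (y^k)_{k≥0} of reals satisfies y^{k+1} ≤ ψ₁·y^k + ψ₂·(γ^k)² for all k ≥ 0 and y⁰ ≤ ψ₂·(γ⁰)², then for every k ≥ 0: y^k ≤ (2ψ₂/(1−ψ₁))·(γ^k)². -/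
open Filter Finset
open scoped BigOperators Topology InnerProductSpace

theorem statement_10
    (ψ₁ ψ₂ : ℝ) (hψ₁ : 0 < ψ₁) (hψ₁' : ψ₁ < 1) (hψ₂ : 0 ≤ ψ₂)
    (γ : ℕ → ℝ) (hγpos : ∀ k, 0 < γ k)
    (hratio : ∀ k : ℕ, 1 ≤ (γ k) ^ 2 / (γ (k + 1)) ^ 2 ∧
      (γ k) ^ 2 / (γ (k + 1)) ^ 2 ≤ 2 / (1 + ψ₁))
    (y : ℕ → ℝ)
    (hrec : ∀ k : ℕ, y (k + 1) ≤ ψ₁ * y k + ψ₂ * (γ k) ^ 2)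
    (h0 : y 0 ≤ ψ₂ * (γ 0) ^ 2) :
    ∀ k : ℕ, y k ≤ (2 * ψ₂ / (1 - ψ₁)) * (γ k) ^ 2 := by
  have h1 : 0 < 1 - ψ₁ := by linarith
  intro k
  induction k with
  | zero =>
    refine h0.trans (mul_le_mul_of_nonneg_right ?_ (sq_nonneg _))
    rw [le_div_iff₀ h1]
    nlinarith [mul_nonneg hψ₂ hψ₁.le]
  | succ k ih =>
    have hγ : (1 + ψ₁) * γ k ^ 2 ≤ 2 * γ (k + 1) ^ 2 := by
      have h := (hratio k).2
      rw [div_le_div_iff₀ (pow_pos (hγpos (k + 1)) 2) (by linarith)] at h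
      linarith
    calc y (k + 1) ≤ ψ₁ * y k + ψ₂ * γ k ^ 2 := hrec k
      _ ≤ ψ₁ * (2 * ψ₂ / (1 - ψ₁) * γ k ^ 2) + ψ₂ * γ k ^ 2 := by gcongr
      _ = ψ₂ / (1 - ψ₁) * ((1 + ψ₁) * γ k ^ 2) := by field_simp; ring
      _ ≤ ψ₂ / (1 - ψ₁) * (2 * γ (k + 1) ^ 2) :=
        mul_le_mul_of_nonneg_left hγ (div_nonneg hψ₂ h1.le)
      _ = 2 * ψ₂ / (1 - ψ₁) * γ (k + 1) ^ 2 := by ring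
end

section
/- Let k₀ > 1 be an integer, A, B ≥ 0 real constants, and (x^k)_{k≥0} a sequence of nonnegative reals satisfying x^{k+1} ≤ (1 − 1/(k₀+k))·x^k + A/(k₀+k)³ + B/(k₀+k) for every integer k ≥ 0. Then for every k ≥ 0: x^{k+1} ≤ ((k₀−1)/(k₀+k))·x⁰ + A/((k₀+k)(k₀−1)) + B·(k+1)/(k₀+k). -/
open Filter Finset
open scoped BigOperators Topology InnerProductSpace

/-- Multiplying the recursion by `k₀ + k` makes it telescope, using `1 / n² ≤ 1 / (n - 1) - 1 / n`. -/
theorem weighted_le_of_recursion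
    {c A B : ℝ} (hc : 1 < c) (hA : 0 ≤ A) {x : ℕ → ℝ}
    (hrec : ∀ k : ℕ, x (k + 1) ≤
      (1 - 1 / (c + (k : ℝ))) * x k + A / (c + (k : ℝ)) ^ 3 + B / (c + (k : ℝ))) (k : ℕ) :
    (c + k - 1) * x k ≤ (c - 1) * x 0 + A * (1 / (c - 1) - 1 / (c + k - 1)) + B * k := by
  induction k with
  | zero => simp
  | succ k ih =>
    have hk : (0 : ℝ) ≤ k := k.cast_nonneg
    have hn : 0 < c + k := by linarith
    have hn' : 0 < c + k - 1 := by linarith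
    have hstep : (c + k) * x (k + 1) ≤ (c + k - 1) * x k + A * (1 / (c + k) ^ 2) + B := by
      calc (c + k) * x (k + 1)
          ≤ (c + k) * ((1 - 1 / (c + k)) * x k + A / (c + k) ^ 3 + B / (c + k)) :=
            mul_le_mul_of_nonneg_left (hrec k) hn.le
        _ = (c + k - 1) * x k + A * (1 / (c + k) ^ 2) + B := by field_simp
    have hsq : 1 / (c + k) ^ 2 ≤ 1 / (c + k - 1) - 1 / (c + k) := by
      rw [div_sub_div _ _ hn'.ne' hn.ne', div_le_div_iff₀ (by positivity) (by positivity)]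
      nlinarith
    have hAsq := mul_le_mul_of_nonneg_left hsq hA
    have hcast : c + ((k + 1 : ℕ) : ℝ) - 1 = c + k := by push_cast; ring
    rw [hcast]
    push_cast
    linarith

theorem statement_12
    (k₀ : ℕ) (hk₀ : 1 < k₀) (A B : ℝ) (hA : 0 ≤ A) (hB : 0 ≤ B)
    (x : ℕ → ℝ) (hx : ∀ k, 0 ≤ x k)
    (hrec : ∀ k : ℕ, x (k + 1) ≤
      (1 - 1 / ((k₀ : ℝ) + (k : ℝ))) * x k + A / ((k₀ : ℝ) + (k : ℝ)) ^ 3 +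
        B / ((k₀ : ℝ) + (k : ℝ))) :
    ∀ k : ℕ, x (k + 1) ≤
      ((k₀ : ℝ) - 1) / ((k₀ : ℝ) + (k : ℝ)) * x 0 +
        A / (((k₀ : ℝ) + (k : ℝ)) * ((k₀ : ℝ) - 1)) +
        B * ((k : ℝ) + 1) / ((k₀ : ℝ) + (k : ℝ)) := by
  intro k
  have hc : (1 : ℝ) < k₀ := by exact_mod_cast hk₀
  have hn : 0 < (k₀ : ℝ) + k := by positivity
  have hc' : 0 < (k₀ : ℝ) - 1 := by linarith
  have h := weighted_le_of_recursion hc hA hrec (k + 1)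
  have hcast : (k₀ : ℝ) + ((k + 1 : ℕ) : ℝ) - 1 = k₀ + k := by push_cast; ring
  rw [hcast] at h
  push_cast at h
  have hdrop : 0 ≤ A * (1 / ((k₀ : ℝ) + k)) := by positivity
  calc x (k + 1)
      ≤ (((k₀ : ℝ) - 1) * x 0 + A * (1 / ((k₀ : ℝ) - 1)) + B * (k + 1)) / (k₀ + k) := by
        rw [le_div_iff₀ hn]
        linarith
    _ = _ := by field_simp
end

section
/- Let E ∈ ℝ^{H×H} be a row-stochastic matrix (E1 = 1) and set χ² := (1/H)‖Eᵀ1 − 1‖². Then for every matrix Λ ∈ ℝ^{H×D}: ‖(1/H)1ᵀEΛ − (1/H)1ᵀΛ‖² ≤ (χ²/H)·‖Λ − (1/H)11ᵀΛ‖_F², where the left-hand side is the squared Euclidean norm of a row vector in ℝ^D. -/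
open Filter Finset
open scoped BigOperators Topology InnerProductSpace

/-- The column-sum defects of a row-stochastic matrix sum to zero. -/
theorem sum_colSum_sub_one_eq_zero {n : Type*} [Fintype n] (E : Matrix n n ℝ)
    (hE : ∀ i, ∑ j, E i j = 1) : ∑ k, ((∑ i, E i k) - 1) = 0 := by
  rw [Finset.sum_sub_distrib, Finset.sum_comm]
  simp [hE]

/-- Multiplying by a row-stochastic matrix changes the column sums by the pairing of the
column-sum defects with the columns, shifted by any constant. -/
theorem sum_mul_sub_sum_eq {n p : Type*} [Fintype n] (E : Matrix n n ℝ)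
    (hE : ∀ i, ∑ j, E i j = 1) (A : Matrix n p ℝ) (j : p) (m : ℝ) :
    ∑ i, (E * A) i j - ∑ i, A i j = ∑ k, ((∑ i, E i k) - 1) * (A k j - m) := by
  have h : ∑ i, (E * A) i j = ∑ k, (∑ i, E i k) * A k j := by
    simp only [Matrix.mul_apply, Finset.sum_mul]
    exact Finset.sum_comm
  simp_rw [mul_sub]
  rw [Finset.sum_sub_distrib, ← Finset.sum_mul, sum_colSum_sub_one_eq_zero E hE, h,
    ← Finset.sum_sub_distrib]
  simp [sub_mul]

theorem statement_15
    (D H : ℕ)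
    (Evw : Matrix (Fin H) (Fin H) ℝ)
    (hErow : ∀ i, ∑ j, Evw i j = 1)
    (χsq : ℝ) (hχ : χsq = (H : ℝ)⁻¹ * ∑ j, ((∑ i, Evw i j) - 1) ^ 2)
    (Λ : Matrix (Fin H) (Fin D) ℝ) :
    ∑ j, ((H : ℝ)⁻¹ * (∑ i, (Evw * Λ) i j) - (H : ℝ)⁻¹ * (∑ i, Λ i j)) ^ 2 ≤
      χsq / (H : ℝ) * ∑ i, ∑ j,
        ((Λ - (Matrix.of fun _ _ => (H : ℝ)⁻¹ : Matrix (Fin H) (Fin H) ℝ) * Λ) i j) ^ 2 := by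
  rw [Finset.sum_comm (s := univ (α := Fin H)) (t := univ (α := Fin D)), Finset.mul_sum]
  refine Finset.sum_le_sum fun j _ => ?_
  have hmean : ∀ i, (Λ - (Matrix.of fun _ _ => (H : ℝ)⁻¹ : Matrix (Fin H) (Fin H) ℝ) * Λ) i j
      = Λ i j - ∑ k, (H : ℝ)⁻¹ * Λ k j := fun i => by
    simp [Matrix.mul_apply]
  simp only [hmean]
  rw [← mul_sub, sum_mul_sub_sum_eq Evw hErow Λ j (∑ k, (H : ℝ)⁻¹ * Λ k j), mul_pow, hχ,
    div_eq_mul_inv, mul_right_comm (H : ℝ)⁻¹, ← sq, mul_assoc]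
  gcongr
  exact Finset.sum_mul_sq_le_sq_mul_sq _ _ _
end
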